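/- Assume γ = D_d − p ≥ 0. Then in the ring of Laurent polynomials ℤ[X, X⁻¹] the following identity holds: ∑_{j=1}^{p−1} X^{j − sht(j)} + ∑_{i=0}^{γ} X^{−i} = ∑_{y ∈ F} ( X^{N_{r_y} − 1} + X^{N_{r_y} − 2} + ⋯ + X + 1 ) · X^{θ(y)}, where the sum on the right runs over all y ∈ F and r_y denotes the reduced denominator of y. -/

import Mathlib

/-- `sht(j) = ∑_{(λ,i)∈I*} ⌊ij/p⌋` where `I* = {(λ,i) : 1 ≤ i ≤ d λ}`. -/
noncomputable def sht (p l : ℕ) (d : Fin l → ℕ) (j : ℕ) : ℤ :=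
  ∑ lam : Fin l, ∑ i ∈ Finset.Icc 1 (d lam), ⌊(i * j : ℚ) / p⌋

/-- `θ(y) = 1 − ⌊y⌋ + ⌊py⌋ − ∑_{(λ,i)∈I*} ⌊iy⌋`. -/
noncomputable def theta (p l : ℕ) (d : Fin l → ℕ) (y : ℚ) : ℤ :=
  1 - ⌊y⌋ + ⌊(p : ℚ) * y⌋ - ∑ lam : Fin l, ∑ i ∈ Finset.Icc 1 (d lam), ⌊(i : ℚ) * y⌋

/-- `N_r = #{(λ,i) ∈ I* : r ∣ i}`. -/
def Nr (l : ℕ) (d : Fin l → ℕ) (r : ℕ) : ℕ :=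
  ∑ lam : Fin l, ((Finset.Icc 1 (d lam)).filter (fun i => r ∣ i)).card

/-- `D_d = ∑_λ d_λ(d_λ+1)/2`. -/
def Dd (l : ℕ) (d : Fin l → ℕ) : ℕ :=
  ∑ lam : Fin l, d lam * (d lam + 1) / 2

/-- The Farey set of order `M`: the rationals `s/r` with `1 ≤ s ≤ r ≤ M`,
i.e. `(⋃_{j=1}^M (1/j)ℤ) ∩ (0,1]`, as a finite set. -/
def fareyFinset (M : ℕ) : Finset ℚ :=
  (Finset.Icc 1 M).biUnion (fun r => (Finset.Icc 1 r).image (fun s : ℕ => (s : ℚ) / (r : ℚ)))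

/-- The Farey set of order `M`: `F = (⋃_{j=1}^M (1/j)ℤ) ∩ (0,1]`. -/
def fareySet (M : ℕ) : Set ℚ :=
  {y | (∃ j : ℕ, 1 ≤ j ∧ j ≤ M ∧ ∃ k : ℤ, y = (k : ℚ) / (j : ℚ)) ∧ 0 < y ∧ y ≤ 1}

open LaurentPolynomial in
lemma T_sub_ne : (T 1 - 1 : LaurentPolynomial ℤ) ≠ 0 := by
  intro h
  have h1 : (T 1 : LaurentPolynomial ℤ) = T 0 := by rw [T_zero]; exact sub_eq_zero.mp h
  have h2 := congrArg LaurentPolynomial.degree h1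
  rw [degree_T, degree_T] at h2
  exact absurd h2 (by decide)

open LaurentPolynomial in
lemma geomT (n : ℕ) : (T 1 - 1 : LaurentPolynomial ℤ) * ∑ i ∈ Finset.range n, T (i:ℤ) = T n - 1 := by
  induction n with
  | zero => simp
  | succ n ih =>
    rw [Finset.sum_range_succ, mul_add, ih, sub_mul, ← T_add]
    push_cast
    rw [add_comm (1:ℤ)]
    ring

open LaurentPolynomial in
lemma geomTneg (n : ℕ) : (T 1 - 1 : LaurentPolynomial ℤ) * ∑ i ∈ Finset.range (n+1), T (-(i:ℤ))
    = T 1 - T (-(n:ℤ)) := by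
  induction n with
  | zero => simp
  | succ n ih =>
    rw [Finset.sum_range_succ, mul_add, ih, sub_mul, ← T_add]
    push_cast
    rw [show (1:ℤ) + -(n+1) = -n by ring]
    ring

lemma den_dvd_iff (i q k Q : ℕ) (hQ : 0 < Q) (h : Q = i * q) :
    (((k:ℕ):ℚ)/Q).den ∣ i ↔ q ∣ k := by
  have hi : 0 < i := Nat.pos_of_mul_pos_right (h ▸ hQ)
  have hq : 0 < q := Nat.pos_of_mul_pos_left (h ▸ hQ)
  constructor
  · rintro ⟨c, hc⟩
    set y : ℚ := (k:ℚ)/Q with hy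
    have h1 : y * y.den = y.num := Rat.mul_den_eq_num y
    have h2 : y * Q = k := by rw [hy]; field_simp
    have h3 : (k:ℚ) = (q:ℚ) * (c * y.num) := by
      rw [← h2, ← h1]
      have : (Q:ℚ) = y.den * c * q := by rw [h]; conv_lhs => rw [hc]
                                         push_cast; ring
      rw [this]; ring
    have h4 : (k:ℤ) = (q:ℤ) * (c * y.num) := by exact_mod_cast h3
    exact Int.natCast_dvd_natCast.mp ⟨_, h4⟩
  · rintro ⟨m, rfl⟩
    have : (((q*m:ℕ):ℚ)/Q) = ((m:ℤ):ℚ)/((i:ℤ):ℚ) := by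
      rw [h]; push_cast; field_simp
    rw [this]
    have h5 := Rat.den_dvd m i
    rw [Rat.divInt_eq_div] at h5
    exact Int.natCast_dvd_natCast.mp h5

lemma floor_eq (i q k Q : ℕ) (hQ : 0 < Q) (h : Q = i * q) :
    ⌊(i:ℚ) * ((k:ℚ)/Q)⌋ = ((k / q : ℕ) : ℤ) := by
  have hi : 0 < i := Nat.pos_of_mul_pos_right (h ▸ hQ)
  have hq : 0 < q := Nat.pos_of_mul_pos_left (h ▸ hQ)
  have : (i:ℚ) * ((k:ℚ)/Q) = (k:ℚ)/(q:ℚ) := by rw [h]; push_cast; field_simp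
  rw [this, Rat.floor_natCast_div_natCast]
  simp

lemma jump (i k Q : ℕ) (hQ : 0 < Q) (h : i ∣ Q) :
    ⌊(i:ℚ) * (((k+1:ℕ):ℚ)/Q)⌋ = ⌊(i:ℚ) * ((k:ℚ)/Q)⌋ + if (((k+1:ℕ):ℚ)/Q).den ∣ i then 1 else 0 := by
  obtain ⟨q, h⟩ := h
  rw [floor_eq i q _ Q hQ h, floor_eq i q _ Q hQ h, Nat.succ_div]
  simp only [den_dvd_iff i q _ Q hQ h]
  split_ifs <;> simp

lemma theta_jump (p l : ℕ) (d : Fin l → ℕ) (k Q : ℕ) (hQ : 0 < Q) (hp : p ∣ Q)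
    (hd : ∀ lam, ∀ i ∈ Finset.Icc 1 (d lam), i ∣ Q) :
    theta p l d ((k:ℚ)/Q) = theta p l d (((k+1:ℕ):ℚ)/Q) + Nr l d (((k+1:ℕ):ℚ)/Q).den
      + (if (((k+1:ℕ):ℚ)/Q).den ∣ 1 then 1 else 0) - (if (((k+1:ℕ):ℚ)/Q).den ∣ p then 1 else 0) := by
  unfold theta Nr
  have h1 := jump 1 k Q hQ (one_dvd _)
  rw [Nat.cast_one, one_mul, one_mul] at h1
  have h2 : ∑ lam : Fin l, ∑ i ∈ Finset.Icc 1 (d lam), ⌊(i : ℚ) * (((k+1:ℕ):ℚ)/Q)⌋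
      = ∑ lam : Fin l, ∑ i ∈ Finset.Icc 1 (d lam), ⌊(i : ℚ) * ((k:ℚ)/Q)⌋ +
        ∑ lam : Fin l, ((((Finset.Icc 1 (d lam)).filter (fun i => (((k+1:ℕ):ℚ)/Q).den ∣ i)).card : ℕ) : ℤ) := by
    rw [← Finset.sum_add_distrib]
    refine Finset.sum_congr rfl fun lam _ => ?_
    rw [Finset.card_filter]
    push_cast
    rw [← Finset.sum_add_distrib]
    refine Finset.sum_congr rfl fun i hi => ?_
    have := jump i k Q hQ (hd lam i hi)
    push_cast at this
    exact this
  rw [h1, h2, jump p k Q hQ hp]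
  push_cast
  ring

lemma Nr_zero (l : ℕ) (d : Fin l → ℕ) (r : ℕ) (h : Finset.univ.sup d < r) : Nr l d r = 0 := by
  unfold Nr
  refine Finset.sum_eq_zero fun lam _ => ?_
  rw [Finset.card_eq_zero, Finset.filter_eq_empty_iff]
  intro i hi hr
  rw [Finset.mem_Icc] at hi
  have := Nat.le_of_dvd (by omega) hr
  have := Finset.le_sup (f := d) (Finset.mem_univ lam)
  omega

lemma sum_Icc_id' (n : ℕ) : ∑ i ∈ Finset.Icc 1 n, i = n * (n+1)/2 := by
  have : (∑ i ∈ Finset.Icc 1 n, i) * 2 = n * (n+1) := by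
    induction n with
    | zero => simp
    | succ n ih => rw [Finset.sum_Icc_succ_top (by omega), add_mul, ih]; ring
  omega

lemma theta_zero (p l : ℕ) (d : Fin l → ℕ) : theta p l d 0 = 1 := by
  simp [theta]

lemma theta_one (p l : ℕ) (d : Fin l → ℕ) : theta p l d 1 = p - Dd l d := by
  simp only [theta, Dd, mul_one, Int.floor_natCast, Int.floor_one]
  push_cast [← sum_Icc_id']
  ring

open LaurentPolynomial in
lemma step (p l : ℕ) (hp : p.Prime) (d : Fin l → ℕ) (k Q : ℕ) (hQ : 0 < Q) (hpQ : p ∣ Q)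
    (hM : Finset.univ.sup d < p)
    (hd : ∀ lam, ∀ i ∈ Finset.Icc 1 (d lam), i ∣ Q) :
    (T (theta p l d ((k:ℚ)/Q)) : LaurentPolynomial ℤ) - T (theta p l d (((k+1:ℕ):ℚ)/Q))
    = (T 1 - 1) * ((∑ i ∈ Finset.range (Nr l d (((k+1:ℕ):ℚ)/Q).den), T (i:ℤ))
        * T (theta p l d (((k+1:ℕ):ℚ)/Q))
      - if (((k+1:ℕ):ℚ)/Q).den = p then T (theta p l d (((k+1:ℕ):ℚ)/Q) - 1) else 0) := by
  rw [theta_jump p l d k Q hQ hpQ hd]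
  generalize (((k+1:ℕ):ℚ)/Q) = y
  rw [mul_sub, ← mul_assoc, geomT]
  by_cases h : y.den = p
  · rw [h, Nr_zero l d p hM]
    have : ¬ p ∣ 1 := by simpa using hp.one_lt.ne'
    simp only [this, if_true, if_false, dvd_refl, sub_mul, ← T_add]
    simp
  · have : (y.den ∣ p) ↔ y.den ∣ 1 := by
      rw [Nat.dvd_prime hp, Nat.dvd_one]; tauto
    simp only [this, h, if_false, mul_zero, sub_zero, add_sub_cancel_right, sub_mul, ← T_add, one_mul]
    rw [add_comm]

lemma mem_farey (M : ℕ) (y : ℚ) (h0 : 0 < y) (h1 : y ≤ 1) (hM : y.den ≤ M) : y ∈ fareyFinset M := by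
  unfold fareyFinset
  have hn : 0 < y.num := Rat.num_pos.mpr h0
  have hle : y.num ≤ y.den := by
    have := Rat.num_le_denom_iff.mpr h1
    exact this
  simp only [Finset.mem_biUnion, Finset.mem_image, Finset.mem_Icc]
  refine ⟨y.den, ⟨y.pos, hM⟩, y.num.toNat, ⟨by omega, by omega⟩, ?_⟩
  have h3 : ((y.num.toNat : ℕ) : ℤ) = y.num := Int.toNat_of_nonneg hn.le
  have h4 : ((y.num.toNat : ℕ) : ℚ) = y.num := by exact_mod_cast h3
  rw [h4, Rat.num_div_den]

lemma sum_farey {A : Type*} [AddCommMonoid A] (M Q : ℕ) (hQ : 0 < Q) (hM : ∀ r, 1 ≤ r → r ≤ M → r ∣ Q)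
    (f : ℚ → A) (hf : ∀ y, M < y.den → f y = 0) :
    ∑ y ∈ fareyFinset M, f y = ∑ k ∈ Finset.range Q, f (((k+1:ℕ):ℚ)/Q) := by
  have hQ' : (0:ℚ) < Q := by exact_mod_cast hQ
  rw [← Finset.sum_image (s := Finset.range Q) (g := fun k : ℕ => (((k+1:ℕ):ℚ)/Q)) (f := f)]
  · apply Finset.sum_subset
    · intro y hy
      simp only [fareyFinset, Finset.mem_biUnion, Finset.mem_image, Finset.mem_Icc] at hy
      obtain ⟨r, ⟨hr1, hr2⟩, s, ⟨hs1, hs2⟩, rfl⟩ := hy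
      obtain ⟨q, rfl⟩ := hM r hr1 hr2
      have hq : 0 < q := Nat.pos_of_mul_pos_left hQ
      simp only [Finset.mem_image, Finset.mem_range]
      have : 0 < s * q := Nat.mul_pos hs1 hq
      have h2 : s * q ≤ r * q := Nat.mul_le_mul_right q hs2
      refine ⟨s * q - 1, by omega, ?_⟩
      rw [Nat.sub_add_cancel this]
      push_cast
      field_simp
    · intro y hy hny
      apply hf
      by_contra hc
      apply hny
      simp only [Finset.mem_image, Finset.mem_range] at hy
      obtain ⟨k, hk, rfl⟩ := hy
      apply mem_farey _ _ _ _ (not_lt.mp hc)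
      · positivity
      · rw [div_le_one hQ']; exact_mod_cast hk
  · intro a _ b _ hab
    simp only at hab
    rw [div_left_inj' hQ'.ne'] at hab
    have : a + 1 = b + 1 := by exact_mod_cast hab
    omega

open LaurentPolynomial in
lemma sum_p (p l F Q : ℕ) (hp : p.Prime) (d : Fin l → ℕ) (hF : 0 < F) (hQ : Q = p * F) :
    ∑ k ∈ Finset.range Q, (if (((k+1:ℕ):ℚ)/Q).den = p then
      (T (theta p l d (((k+1:ℕ):ℚ)/Q) - 1) : LaurentPolynomial ℤ) else 0)
    = ∑ j ∈ Finset.Icc 1 (p - 1), T ((j : ℤ) - sht p l d j) := by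
  have hp0 := hp.pos
  have hQ0 : 0 < Q := by rw [hQ]; positivity
  have hden : ∀ k : ℕ, ((k:ℚ)/Q).den = p ↔ F ∣ k ∧ ¬ Q ∣ k := by
    intro k
    rw [← den_dvd_iff p F k Q hQ0 hQ, ← den_dvd_iff 1 Q k Q hQ0 (by simp), Nat.dvd_prime hp, Nat.dvd_one]
    have := hp.one_lt
    constructor
    · intro h; omega
    · intro h; omega
  rw [← Finset.sum_filter]
  symm
  refine Finset.sum_bij (fun j _ => j * F - 1) ?_ ?_ ?_ ?_
  · intro j hj
    rw [Finset.mem_Icc] at hj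
    have h1 : 0 < j * F := Nat.mul_pos hj.1 hF
    have h2 : j * F < p * F := Nat.mul_lt_mul_of_pos_right (by omega) hF
    rw [Finset.mem_filter, Finset.mem_range, Nat.sub_add_cancel h1, hden]
    refine ⟨by omega, Dvd.intro_left j rfl, fun h => ?_⟩
    have := Nat.le_of_dvd h1 h
    omega
  · intro a ha b hb hab
    rw [Finset.mem_Icc] at ha hb
    have h1 : 0 < a * F := Nat.mul_pos ha.1 hF
    have h2 : 0 < b * F := Nat.mul_pos hb.1 hF
    exact Nat.eq_of_mul_eq_mul_right hF (by omega)
  · intro k hk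
    rw [Finset.mem_filter, Finset.mem_range, hden] at hk
    obtain ⟨hk, ⟨j, hj⟩, hn⟩ := hk
    refine ⟨j, ?_, by rw [mul_comm, ← hj]; simp⟩
    rw [Finset.mem_Icc]
    have hj0 : j ≠ 0 := by rintro rfl; omega
    have hjp : j < p := by
      by_contra hc
      have h3 : p * F ≤ F * j := by rw [mul_comm]; exact Nat.mul_le_mul_left F (not_lt.mp hc)
      exact hn (by rw [show k + 1 = Q by omega])
    omega
  · intro j hj
    rw [Finset.mem_Icc] at hj
    have h1 : 0 < j * F := Nat.mul_pos hj.1 hF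
    rw [Nat.sub_add_cancel h1]
    have h2 : ((j * F : ℕ) : ℚ) / Q = (j:ℚ) / p := by
      rw [hQ]; push_cast; field_simp
    rw [h2]
    congr 1
    unfold theta sht
    have h3 : ⌊(j:ℚ)/p⌋ = 0 := by
      rw [Rat.floor_natCast_div_natCast]
      exact_mod_cast Nat.div_eq_of_lt (by omega)
    have h4 : (p:ℚ) * ((j:ℚ)/p) = j := by field_simp
    rw [h3, h4]
    simp only [mul_div_assoc, Int.floor_natCast]
    ring


/-- The Laurent polynomial identity equivalent to the equality of stringy motivic invariants:
`∑_{j=1}^{p−1} X^{j−sht(j)} + ∑_{i=0}^{γ} X^{−i}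
  = ∑_{y∈F} (X^{N_{r_y}−1} + ⋯ + X + 1)·X^{θ(y)}`, assuming `γ = D_d − p ≥ 0`. -/
theorem laurent_identity (p l : ℕ) (hp : p.Prime) (d : Fin l → ℕ)
    (hd : ∀ lam, d lam ≤ p - 1) (hγ : p ≤ Dd l d) :
    (∑ j ∈ Finset.Icc 1 (p - 1),
        (LaurentPolynomial.T ((j : ℤ) - sht p l d j) : LaurentPolynomial ℤ))
      + (∑ i ∈ Finset.range (Dd l d - p + 1),
          (LaurentPolynomial.T (-(i : ℤ)) : LaurentPolynomial ℤ))
    = ∑ y ∈ fareyFinset (Finset.univ.sup d),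
        (∑ i ∈ Finset.range (Nr l d y.den),
          (LaurentPolynomial.T (i : ℤ) : LaurentPolynomial ℤ))
          * LaurentPolynomial.T (theta p l d y) := by
  have hp0 := hp.pos
  set M := Finset.univ.sup d with hMdef
  have hM : M < p := by
    rw [hMdef, Finset.sup_lt_iff (by simpa using hp0)]
    intro lam _
    have := hd lam
    omega
  have hdM : ∀ lam, d lam ≤ M := fun lam => Finset.le_sup (f := d) (Finset.mem_univ lam)
  have hF : 0 < M.factorial := Nat.factorial_pos M
  obtain ⟨Q, hQ⟩ : ∃ Q, Q = p * M.factorial := ⟨_, rfl⟩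
  have hQ0 : 0 < Q := by rw [hQ]; positivity
  have hdiv : ∀ r, 1 ≤ r → r ≤ M → r ∣ Q := fun r h1 h2 =>
    hQ ▸ Dvd.dvd.mul_left (Nat.dvd_factorial h1 h2) p
  have hd' : ∀ lam, ∀ i ∈ Finset.Icc 1 (d lam), i ∣ Q := by
    intro lam i hi
    rw [Finset.mem_Icc] at hi
    exact hdiv i hi.1 (hi.2.trans (hdM lam))
  rw [sum_farey M Q hQ0 hdiv (fun y => (∑ i ∈ Finset.range (Nr l d y.den),
          (LaurentPolynomial.T (i : ℤ) : LaurentPolynomial ℤ))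
          * LaurentPolynomial.T (theta p l d y)) (fun y hy => by simp [Nr_zero l d _ hy]),
    ← sum_p p l _ Q hp d hF hQ]
  apply mul_left_cancel₀ T_sub_ne
  have htel := Finset.sum_range_sub' (fun k : ℕ => 
    (LaurentPolynomial.T (theta p l d ((k:ℚ)/Q)) : LaurentPolynomial ℤ)) Q
  have hQQ : (Q:ℚ)/Q = 1 := div_self (by exact_mod_cast hQ0.ne')
  rw [Finset.sum_congr rfl (fun k _ => step p l hp d k Q hQ0 ⟨_, hQ⟩ hM hd'),
    ← Finset.mul_sum, Finset.sum_sub_distrib, hQQ, theta_one, Nat.cast_zero, zero_div, theta_zero] at htel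
  have hg := geomTneg (Dd l d - p)
  rw [show -((Dd l d - p : ℕ):ℤ) = p - Dd l d by omega] at hg
  linear_combination hg - htel
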